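/- arXiv:2311.11896 — 3 statements merged into one kernel-verified Lean document; each statement's English description precedes it below -/
import Mathlib

section
/- Let d, l be positive integers and let h : P_2(ℝ^d) → ℝ^l have a linear functional derivative δh/δμ such that, for every μ ∈ P_2(ℝ^d), the map x̃ ↦ (δh/δμ)(μ)(x̃) is continuously differentiable and sup_{μ ∈ P_2(ℝ^d)} |∂_{x̃}(δh/δμ)(μ)(x̃)| ≤ l₁ + l₂|x̃| for all x̃ ∈ ℝ^d, where l₁, l₂ ≥ 0 are constants. Then for all μ, μ' ∈ P_2(ℝ^d): |h(μ) − h(μ')| ≤ l₁ W₁(μ, μ') + l₂ (‖μ‖₂ + ‖μ'‖₂) W₂(μ, μ'). In particular, when l₂ = 0, |h(μ) − h(μ')| ≤ l₁ W₁(μ, μ'). -/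
open MeasureTheory

noncomputable section

/-- `π` is a coupling of `μ` and `ν`: its marginals are `μ` and `ν`. -/
def IsCoupling {d : ℕ} (π : Measure (EuclideanSpace ℝ (Fin d) × EuclideanSpace ℝ (Fin d)))
    (μ ν : Measure (EuclideanSpace ℝ (Fin d))) : Prop :=
  π.map Prod.fst = μ ∧ π.map Prod.snd = ν

/-- The `p`-Wasserstein distance
`W_p(μ,ν) = inf_{π coupling} (∫ |ξ−η|^p dπ(ξ,η))^{1/p}`. -/
noncomputable def wassersteinDist {d : ℕ} (p : ℝ)
    (μ ν : Measure (EuclideanSpace ℝ (Fin d))) : ℝ :=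
  sInf { r : ℝ | ∃ π : Measure (EuclideanSpace ℝ (Fin d) × EuclideanSpace ℝ (Fin d)),
    IsProbabilityMeasure π ∧ IsCoupling π μ ν ∧ r = (∫ q, ‖q.1 - q.2‖ ^ p ∂π) ^ (1 / p) }

/-- The moment norm `‖μ‖_p = (∫ |x|^p dμ(x))^{1/p}`. -/
noncomputable def momentNorm {d : ℕ} (p : ℝ) (μ : Measure (EuclideanSpace ℝ (Fin d))) : ℝ :=
  (∫ x, ‖x‖ ^ p ∂μ) ^ (1 / p)

/-- Membership in `P₂(ℝ^d)`: a probability measure with finite second moment. -/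
def MemP2 {d : ℕ} (μ : Measure (EuclideanSpace ℝ (Fin d))) : Prop :=
  IsProbabilityMeasure μ ∧ Integrable (fun x : EuclideanSpace ℝ (Fin d) => ‖x‖ ^ 2) μ

/-- The interpolation `θν₁ + (1−θ)ν₂` of two measures. -/
noncomputable def mixMeasure {d : ℕ} (θ : ℝ) (ν₁ ν₂ : Measure (EuclideanSpace ℝ (Fin d))) :
    Measure (EuclideanSpace ℝ (Fin d)) :=
  (ENNReal.ofReal θ) • ν₁ + (ENNReal.ofReal (1 - θ)) • ν₂

/-- `D` is a linear functional derivative of `h` on `P₂(ℝ^d)`: it has at most quadratic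
growth (uniformly on `P₂` via a function `c`), and for all `ν₁, ν₂ ∈ P₂(ℝ^d)`,
`h(ν₁) − h(ν₂) = ∫₀¹ ∫ D(θν₁ + (1−θ)ν₂)(x) d(ν₁−ν₂)(x) dθ`, where integration against
`ν₁ − ν₂` means the difference of the integrals. -/
def HasLFD {d : ℕ} {F : Type*} [NormedAddCommGroup F] [NormedSpace ℝ F]
    (h : Measure (EuclideanSpace ℝ (Fin d)) → F)
    (D : Measure (EuclideanSpace ℝ (Fin d)) → EuclideanSpace ℝ (Fin d) → F) : Prop :=
  (∃ c : Measure (EuclideanSpace ℝ (Fin d)) → ℝ,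
    ∀ μ, MemP2 μ → ∀ x, ‖D μ x‖ ≤ c μ * (1 + ‖x‖ ^ 2)) ∧
  ∀ ν₁ ν₂, MemP2 ν₁ → MemP2 ν₂ →
    h ν₁ - h ν₂ =
      ∫ θ in (0 : ℝ)..1,
        ((∫ x, D (mixMeasure θ ν₁ ν₂) x ∂ν₁) - ∫ x, D (mixMeasure θ ν₁ ν₂) x ∂ν₂)

section LipschitzEstimates

open Set Topology

/-- A function whose line derivatives grow at most affinely in the base point satisfies the
corresponding trapezoidal increment bound. -/
theorem norm_sub_le_of_hasLineDerivAt {E F : Type*} [NormedAddCommGroup E] [NormedSpace ℝ E]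
    [NormedAddCommGroup F] [NormedSpace ℝ F] {f : E → F} {C₀ C₁ : ℝ} (hC₁ : 0 ≤ C₁)
    (hf : ∀ x v, ∃ f', HasLineDerivAt ℝ f f' x v ∧ ‖f'‖ ≤ (C₀ + C₁ * ‖x‖) * ‖v‖) (x y : E) :
    ‖f x - f y‖ ≤ (C₀ + C₁ / 2 * (‖x‖ + ‖y‖)) * ‖x - y‖ := by
  set v := x - y
  choose f' hf' hbd using fun s : ℝ => hf (y + s • v) v
  have hder : ∀ s : ℝ, HasDerivAt (fun s : ℝ => f (y + s • v) - f y) (f' s) s := by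
    intro s
    have h0 : HasDerivAt (fun t : ℝ => f (y + s • v + t • v)) (f' s) (s - s) := by
      simpa [HasLineDerivAt] using hf' s
    have h1 := (h0.comp_sub_const s s).sub_const (f y)
    refine h1.congr_of_eventuallyEq (Filter.Eventually.of_forall fun t => ?_)
    simp only [add_assoc, ← add_smul, add_sub_cancel]
  have hnorm : ∀ s ∈ Ico (0 : ℝ) 1, ‖y + s • v‖ ≤ (1 - s) * ‖y‖ + s * ‖x‖ := by
    intro s hs
    have : y + s • v = (1 - s) • y + s • x := by
      simp only [v, smul_sub, sub_smul, one_smul]; abel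
    rw [this]
    refine (norm_add_le _ _).trans_eq ?_
    rw [norm_smul, norm_smul, Real.norm_of_nonneg (by linarith [hs.2]),
      Real.norm_of_nonneg hs.1]
  have key := image_norm_le_of_norm_deriv_right_le_deriv_boundary (a := 0) (b := 1)
    (B := fun s => (C₀ * s + C₁ * ((s - s ^ 2 / 2) * ‖y‖ + s ^ 2 / 2 * ‖x‖)) * ‖v‖)
    (B' := fun s => (C₀ + C₁ * ((1 - s) * ‖y‖ + s * ‖x‖)) * ‖v‖)
    (fun s _ => (hder s).continuousAt.continuousWithinAt)
    (fun s _ => (hder s).hasDerivWithinAt) (by simp)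
    (fun s => by
      have h1 : HasDerivAt (fun s : ℝ => s ^ 2 / 2) s s := by
        simpa using (hasDerivAt_pow 2 s).div_const 2
      have h2 := (((hasDerivAt_id s).sub h1).mul_const ‖y‖).add (h1.mul_const ‖x‖)
      exact ((((hasDerivAt_id s).const_mul C₀).add (h2.const_mul C₁)).mul_const ‖v‖).congr_deriv
        (by ring))
    (fun s hs => (hbd s).trans (by gcongr; exact hnorm s hs))
    (right_mem_Icc.2 zero_le_one)
  refine le_trans (le_of_eq ?_) (key.trans_eq ?_)
  · simp [v]
  · ring

/-- The derivative of the cutoff `r ↦ r (3 + r) / ((1 + r) (2 + r))`. -/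
def cutoffDeriv (t : ℝ) : ℝ := 2 / (1 + t) ^ 2 - 2 / (2 + t) ^ 2

theorem hasDerivAt_cutoff {r : ℝ} (hr : 0 ≤ r) :
    HasDerivAt (fun r : ℝ => r * ((3 + r) / ((1 + r) * (2 + r)))) (cutoffDeriv r) r := by
  have h1 : HasDerivAt (fun r : ℝ => 3 + r) 1 r := (hasDerivAt_id r).const_add 3
  have h2 : HasDerivAt (fun r : ℝ => 1 + r) 1 r := (hasDerivAt_id r).const_add 1
  have h3 : HasDerivAt (fun r : ℝ => 2 + r) 1 r := (hasDerivAt_id r).const_add 2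
  have p1 : 1 + r ≠ 0 := by positivity
  have p2 : 2 + r ≠ 0 := by positivity
  refine ((hasDerivAt_id r).mul (h1.div (h2.mul h3) (mul_ne_zero p1 p2))).congr_deriv ?_
  simp only [id, Pi.mul_apply, Pi.div_apply, cutoffDeriv]
  field_simp
  ring

theorem cutoffDeriv_nonneg {t : ℝ} (ht : 0 ≤ t) : 0 ≤ cutoffDeriv t := by
  unfold cutoffDeriv
  rw [sub_nonneg]
  gcongr
  norm_num

theorem hasDerivAt_cutoffDeriv {t : ℝ} (ht : 0 ≤ t) :
    HasDerivAt cutoffDeriv (4 / (2 + t) ^ 3 - 4 / (1 + t) ^ 3) t := by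
  have h2 : HasDerivAt (fun r : ℝ => 1 + r) 1 t := (hasDerivAt_id t).const_add 1
  have h3 : HasDerivAt (fun r : ℝ => 2 + r) 1 t := (hasDerivAt_id t).const_add 2
  have p1 : 1 + t ≠ 0 := by positivity
  have p2 : 2 + t ≠ 0 := by positivity
  refine (((hasDerivAt_const t (2 : ℝ)).div (h2.pow 2) (pow_ne_zero 2 p1)).sub
    ((hasDerivAt_const t (2 : ℝ)).div (h3.pow 2) (pow_ne_zero 2 p2))).congr_deriv ?_
  simp only [Pi.pow_apply]
  field_simp
  ring

theorem intervalIntegral_cutoffDeriv_le {r : ℝ} (hr : 0 ≤ r) :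
    ∫ τ in (0 : ℝ)..1, cutoffDeriv (r * τ) * τ ^ 2 * (1 + r * τ) ≤ 1 / (2 + r) := by
  have hpos : ∀ τ ∈ Icc (0 : ℝ) 1, 0 ≤ r * τ := fun τ hτ => mul_nonneg hr hτ.1
  have hder : ∀ τ ∈ uIcc (0 : ℝ) 1, HasDerivAt (fun τ : ℝ => τ ^ 3 / (2 + r * τ))
      (τ ^ 2 * (6 + 2 * (r * τ)) / (2 + r * τ) ^ 2) τ := by
    intro τ hτ
    rw [uIcc_of_le zero_le_one] at hτ
    have p2 : 2 + r * τ ≠ 0 := by have := hpos τ hτ; positivity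
    refine ((hasDerivAt_pow 3 τ).div (((hasDerivAt_id τ).const_mul r).const_add 2)
      p2).congr_deriv ?_
    simp only [id]
    push_cast
    ring
  have hc1 : ContinuousOn (fun τ : ℝ => τ ^ 2 * (6 + 2 * (r * τ)) / (2 + r * τ) ^ 2)
      (uIcc 0 1) := by
    rw [uIcc_of_le zero_le_one]
    refine ContinuousOn.div (by fun_prop) (by fun_prop) fun τ hτ => ?_
    have := hpos τ hτ; positivity
  have hc2 : ContinuousOn (fun τ : ℝ => cutoffDeriv (r * τ) * τ ^ 2 * (1 + r * τ))
      (uIcc 0 1) := by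
    rw [uIcc_of_le zero_le_one]
    have : ContinuousOn (fun τ : ℝ => cutoffDeriv (r * τ)) (Icc 0 1) := fun τ hτ =>
      ((hasDerivAt_cutoffDeriv (hpos τ hτ)).continuousAt.comp
        (f := fun τ => r * τ) (by fun_prop)).continuousWithinAt
    fun_prop
  have hint := intervalIntegral.integral_eq_sub_of_hasDerivAt hder hc1.intervalIntegrable
  calc _ ≤ ∫ τ in (0 : ℝ)..1, τ ^ 2 * (6 + 2 * (r * τ)) / (2 + r * τ) ^ 2 := by
        refine intervalIntegral.integral_mono_on zero_le_one hc2.intervalIntegrable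
          hc1.intervalIntegrable fun τ hτ => ?_
        have h := hpos τ hτ
        have : cutoffDeriv (r * τ) * (1 + r * τ) ≤ (6 + 2 * (r * τ)) / (2 + r * τ) ^ 2 := by
          generalize r * τ = t at h
          have : cutoffDeriv t * (1 + t) = 2 * (2 * t + 3) / (1 + t) / (2 + t) ^ 2 := by
            unfold cutoffDeriv; field_simp; ring
          rw [this]
          gcongr
          rw [div_le_iff₀ (by positivity)]
          nlinarith
        calc _ = τ ^ 2 * (cutoffDeriv (r * τ) * (1 + r * τ)) := by ring
          _ ≤ τ ^ 2 * ((6 + 2 * (r * τ)) / (2 + r * τ) ^ 2) := by gcongr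
          _ = _ := by ring
    _ = _ := by rw [hint]; simp

theorem continuousOn_cutoffDeriv : ContinuousOn cutoffDeriv (Ici 0) := fun _ ht =>
  (hasDerivAt_cutoffDeriv ht).continuousAt.continuousWithinAt

/-- Differentiation under the integral sign for integrands that are `C¹` in the parameter. -/
theorem hasDerivAt_intervalIntegral_of_continuousOn {F : Type*} [NormedAddCommGroup F]
    [NormedSpace ℝ F] {K K' : ℝ → ℝ → F} {s₀ δ : ℝ} (hδ : 0 < δ)
    (hK : ∀ s ∈ Metric.closedBall s₀ δ, ContinuousOn (K s) (Icc 0 1))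
    (hK' : ContinuousOn (Function.uncurry K') (Metric.closedBall s₀ δ ×ˢ Icc 0 1))
    (hder : ∀ s ∈ Metric.closedBall s₀ δ, ∀ τ ∈ Icc (0 : ℝ) 1,
      HasDerivAt (fun s => K s τ) (K' s τ) s) :
    HasDerivAt (fun s => ∫ τ in (0 : ℝ)..1, K s τ) (∫ τ in (0 : ℝ)..1, K' s₀ τ) s₀ := by
  obtain ⟨C, hC⟩ := ((isCompact_closedBall s₀ δ).prod isCompact_Icc).exists_bound_of_continuousOn hK'
  have hmem : Metric.closedBall s₀ δ ∈ 𝓝 s₀ := Metric.closedBall_mem_nhds s₀ hδ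
  have hs₀ : s₀ ∈ Metric.closedBall s₀ δ := Metric.mem_closedBall_self hδ.le
  have hII : ∀ f : ℝ → F, ContinuousOn f (Icc 0 1) → IntervalIntegrable f volume 0 1 :=
    fun f hf => ContinuousOn.intervalIntegrable (by rwa [uIcc_of_le zero_le_one])
  have hsub : ∀ τ ∈ uIoc (0 : ℝ) 1, τ ∈ Icc (0 : ℝ) 1 := fun τ hτ => by
    rw [uIoc_of_le zero_le_one] at hτ; exact ⟨hτ.1.le, hτ.2⟩
  have hK'₀ : ContinuousOn (K' s₀) (Icc 0 1) :=
    hK'.comp (f := fun τ => (s₀, τ)) (by fun_prop) fun τ hτ => ⟨hs₀, hτ⟩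
  refine (intervalIntegral.hasDerivAt_integral_of_dominated_loc_of_deriv_le
    (bound := fun _ => C) hmem ?_ (hII _ (hK s₀ hs₀)) ?_ ?_ intervalIntegrable_const ?_).2
  · filter_upwards [hmem] with s hs
    rw [uIoc_of_le zero_le_one]
    exact (hII _ (hK s hs)).aestronglyMeasurable
  · rw [uIoc_of_le zero_le_one]
    exact (hII _ hK'₀).aestronglyMeasurable
  · exact Filter.Eventually.of_forall fun τ hτ s hs => hC (s, τ) ⟨hs, hsub τ hτ⟩
  · exact Filter.Eventually.of_forall fun τ hτ s hs => hder s hs τ (hsub τ hτ)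

section RadialAverage

variable {E F : Type*} [NormedAddCommGroup E] [InnerProductSpace ℝ E]
  [NormedAddCommGroup F] [NormedSpace ℝ F]

theorem hasDerivAt_norm_add_smul {x v : E} {s : ℝ} (h : x + s • v ≠ 0) :
    HasDerivAt (fun s : ℝ => ‖x + s • v‖) (inner ℝ (x + s • v) v / ‖x + s • v‖) s := by
  have h1 : HasDerivAt (fun s : ℝ => x + s • v) v s := by
    simpa using ((hasDerivAt_id s).smul_const v).const_add x
  have h2 := h1.norm_sq.sqrt (pow_ne_zero 2 (norm_ne_zero_iff.2 h))
  simp only [Real.sqrt_sq (norm_nonneg _)] at h2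
  refine h2.congr_deriv ?_
  field_simp

/-- The average of `g` along the ray through `x`, evaluated at `τ² x` for `τ ∈ [0, 1]` and
weighted by the derivative of the cutoff. -/
def radialAverage (g : E → F) (x : E) : F :=
  ∫ τ in (0 : ℝ)..1, cutoffDeriv (‖x‖ * |τ|) • g (τ ^ 2 • x)

theorem continuous_radialAverage {g : E → F} (hg : Continuous g) :
    Continuous (radialAverage g) := by
  refine intervalIntegral.continuous_parametric_intervalIntegral_of_continuous' ?_ 0 1
  refine Continuous.smul (f := fun q : E × ℝ => cutoffDeriv (‖q.1‖ * |q.2|)) ?_ (by fun_prop)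
  exact continuousOn_cutoffDeriv.comp_continuous (by fun_prop) fun q =>
    mul_nonneg (norm_nonneg _) (abs_nonneg _)

theorem norm_smul_radialAverage (g : E → F) (x : E) :
    ‖x‖ • radialAverage g x =
      ∫ τ in (0 : ℝ)..1, (‖x‖ * cutoffDeriv (‖x‖ * τ)) • g (τ ^ 2 • x) := by
  rw [radialAverage, ← intervalIntegral.integral_smul]
  refine intervalIntegral.integral_congr fun τ hτ => ?_
  rw [uIcc_of_le zero_le_one] at hτ
  simp only [abs_of_nonneg hτ.1, smul_smul]

/-- The remainder in the derivative of `x ↦ ‖x‖ • radialAverage g x` in direction `v`: the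
differential of `g` is applied to the reflection of `v` in the hyperplane orthogonal to `x`. -/
def radialRemainder (g : E → F) (x v : E) : F :=
  ∫ τ in (0 : ℝ)..1, (‖x‖ * cutoffDeriv (‖x‖ * τ) * τ ^ 2) •
    fderiv ℝ g (τ ^ 2 • x) (v - (2 * inner ℝ x v / ‖x‖ ^ 2) • x)

theorem hasLineDerivAt_norm_smul_radialAverage [CompleteSpace F] {g : E → F}
    (hg : ContDiff ℝ 1 g) {x : E} (hx : x ≠ 0) (v : E) :
    HasLineDerivAt ℝ (fun x => ‖x‖ • radialAverage g x)
      ((cutoffDeriv ‖x‖ * (inner ℝ x v / ‖x‖)) • g x + radialRemainder g x v) x v := by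
  obtain ⟨p', hp'_def⟩ : ∃ p' : ℝ → ℝ, p' = fun t => 4 / (2 + t) ^ 3 - 4 / (1 + t) ^ 3 := ⟨_, rfl⟩
  have hp' : ContinuousOn p' (Ici 0) := by
    rw [hp'_def]
    refine ContinuousOn.sub (ContinuousOn.div (by fun_prop) (by fun_prop) fun t ht => ?_)
      (ContinuousOn.div (by fun_prop) (by fun_prop) fun t ht => ?_) <;>
    · have : (0 : ℝ) ≤ t := ht
      positivity
  have hdg : Continuous fun q : E × E => fderiv ℝ g q.1 q.2 :=
    hg.continuous_fderiv_apply one_ne_zero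
  have hcont : Continuous g := hg.continuous
  obtain ⟨δ, hδ, hball⟩ : ∃ δ > 0, ∀ s ∈ Metric.closedBall (0 : ℝ) δ, x + s • v ≠ 0 := by
    have hline : ContinuousAt (fun s : ℝ => x + s • v) 0 := by fun_prop
    have : ∀ᶠ s : ℝ in 𝓝 0, x + s • v ≠ 0 := hline.eventually_ne (by simpa using hx)
    obtain ⟨δ, hδ, h⟩ := Metric.nhds_basis_closedBall.eventually_iff.1 this
    exact ⟨δ, hδ, fun s hs => h hs⟩
  obtain ⟨n, hn_def⟩ : ∃ n : ℝ → ℝ, n = fun s => ‖x + s • v‖ := ⟨_, rfl⟩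
  obtain ⟨n', hn'_def⟩ : ∃ n' : ℝ → ℝ, n' = fun s => inner ℝ (x + s • v) v / ‖x + s • v‖ :=
    ⟨_, rfl⟩
  have hn : ∀ s, 0 ≤ n s := fun s => by rw [hn_def]; exact norm_nonneg _
  have hnc : Continuous n := by rw [hn_def]; fun_prop
  have hn'c : ContinuousOn n' (Metric.closedBall 0 δ) := by
    rw [hn'_def]
    exact ContinuousOn.div (by fun_prop) (by fun_prop) fun s hs => norm_ne_zero_iff.2 (hball s hs)
  set K : ℝ → ℝ → F := fun s τ => (n s * cutoffDeriv (n s * τ)) • g (τ ^ 2 • (x + s • v))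
  set K' : ℝ → ℝ → F := fun s τ =>
    (n' s * (cutoffDeriv (n s * τ) + n s * τ * p' (n s * τ))) • g (τ ^ 2 • (x + s • v)) +
      (n s * cutoffDeriv (n s * τ)) • fderiv ℝ g (τ ^ 2 • (x + s • v)) (τ ^ 2 • v)
  have hmain : HasDerivAt (fun s => ∫ τ in (0 : ℝ)..1, K s τ) (∫ τ in (0 : ℝ)..1, K' 0 τ) 0 := by
    refine hasDerivAt_intervalIntegral_of_continuousOn hδ ?_ ?_ ?_
    · intro s _
      have : ContinuousOn (fun τ => cutoffDeriv (n s * τ)) (Icc 0 1) :=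
        continuousOn_cutoffDeriv.comp (by fun_prop) fun τ hτ => mul_nonneg (hn s) hτ.1
      fun_prop
    · have hm : MapsTo (fun q : ℝ × ℝ => n q.1 * q.2) (Metric.closedBall 0 δ ×ˢ Icc 0 1) (Ici 0) :=
        fun q hq => mul_nonneg (hn _) hq.2.1
      have h1 : ContinuousOn (fun q : ℝ × ℝ => cutoffDeriv (n q.1 * q.2))
          (Metric.closedBall 0 δ ×ˢ Icc 0 1) :=
        continuousOn_cutoffDeriv.comp (by fun_prop) hm
      have h2 : ContinuousOn (fun q : ℝ × ℝ => p' (n q.1 * q.2))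
          (Metric.closedBall 0 δ ×ˢ Icc 0 1) := hp'.comp (by fun_prop) hm
      have h3 : ContinuousOn (fun q : ℝ × ℝ => n' q.1) (Metric.closedBall 0 δ ×ˢ Icc 0 1) :=
        hn'c.comp (by fun_prop) fun q hq => hq.1
      have h4 : Continuous fun q : ℝ × ℝ =>
          fderiv ℝ g (q.2 ^ 2 • (x + q.1 • v)) (q.2 ^ 2 • v) :=
        hdg.comp (f := fun q : ℝ × ℝ => (q.2 ^ 2 • (x + q.1 • v), q.2 ^ 2 • v)) (by fun_prop)
      have h5 : Continuous fun q : ℝ × ℝ => g (q.2 ^ 2 • (x + q.1 • v)) := by fun_prop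
      have h6 : Continuous fun q : ℝ × ℝ => n q.1 := hnc.comp continuous_fst
      exact ((h3.mul (h1.add ((h6.mul continuous_snd).continuousOn.mul h2))).smul
        h5.continuousOn).add ((h6.continuousOn.mul h1).smul h4.continuousOn)
    · intro s hs τ hτ
      have hd : HasDerivAt n (n' s) s := by
        rw [hn_def, hn'_def]; exact hasDerivAt_norm_add_smul (hball s hs)
      have hc := hasDerivAt_cutoffDeriv (mul_nonneg (hn s) hτ.1)
      have h1 := hd.mul (hc.comp s (hd.mul_const τ))
      have h2 : HasDerivAt (fun s : ℝ => τ ^ 2 • (x + s • v)) (τ ^ 2 • v) s := by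
        exact ((((hasDerivAt_id s).smul_const v).const_add x).const_smul (τ ^ 2)).congr_deriv
          (by simp)
      have h3 := (hg.differentiable one_ne_zero _).hasFDerivAt.comp_hasDerivAt s h2
      refine (h1.smul h3).congr_deriv ?_
      simp only [K', hp'_def, Function.comp]
      rw [add_comm]
      congr 2
      ring
  have hv : n' 0 = inner ℝ x v / ‖x‖ := by simp [hn'_def]
  have hn0 : n 0 = ‖x‖ := by simp [hn_def]
  have hxn : ‖x‖ ≠ 0 := norm_ne_zero_iff.2 hx
  set R : ℝ → F := fun τ => (‖x‖ * cutoffDeriv (‖x‖ * τ) * τ ^ 2) •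
    fderiv ℝ g (τ ^ 2 • x) (v - (2 * inner ℝ x v / ‖x‖ ^ 2) • x)
  set S : ℝ → F := fun τ => (cutoffDeriv (‖x‖ * τ) + ‖x‖ * τ * p' (‖x‖ * τ)) • g (τ ^ 2 • x) +
    (τ * cutoffDeriv (‖x‖ * τ)) • fderiv ℝ g (τ ^ 2 • x) ((2 * τ) • x)
  have hpc : ContinuousOn (fun τ => cutoffDeriv (‖x‖ * τ)) (Icc 0 1) :=
    continuousOn_cutoffDeriv.comp (by fun_prop) fun τ hτ => mul_nonneg (norm_nonneg x) hτ.1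
  have hpc' : ContinuousOn (fun τ => p' (‖x‖ * τ)) (Icc 0 1) :=
    hp'.comp (by fun_prop) fun τ hτ => mul_nonneg (norm_nonneg x) hτ.1
  have hdgτ : ∀ w : ℝ → E, Continuous w → Continuous fun τ : ℝ => fderiv ℝ g (τ ^ 2 • x) (w τ) :=
    fun w hw => hdg.comp (f := fun τ : ℝ => (τ ^ 2 • x, w τ)) (by fun_prop)
  have hRI : IntervalIntegrable R volume 0 1 := by
    refine ContinuousOn.intervalIntegrable ?_
    rw [uIcc_of_le zero_le_one]
    have := hdgτ (fun _ => v - (2 * inner ℝ x v / ‖x‖ ^ 2) • x) continuous_const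
    fun_prop
  have hSI : IntervalIntegrable S volume 0 1 := by
    refine ContinuousOn.intervalIntegrable ?_
    rw [uIcc_of_le zero_le_one]
    have h1 := hdgτ (fun τ => (2 * τ) • x) (by fun_prop)
    have h2 : ContinuousOn (fun τ => ‖x‖ * τ * p' (‖x‖ * τ)) (Icc 0 1) :=
      ContinuousOn.mul (by fun_prop) hpc'
    exact ((hpc.add h2).smul (by fun_prop)).add
      ((continuousOn_id.mul hpc).smul h1.continuousOn)
  have hS : ∫ τ in (0 : ℝ)..1, S τ = cutoffDeriv ‖x‖ • g x := by
    have hder : ∀ τ ∈ uIcc (0 : ℝ) 1,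
        HasDerivAt (fun τ : ℝ => (τ * cutoffDeriv (‖x‖ * τ)) • g (τ ^ 2 • x)) (S τ) τ := by
      intro τ hτ
      rw [uIcc_of_le zero_le_one] at hτ
      have hc := hasDerivAt_cutoffDeriv (mul_nonneg (norm_nonneg x) hτ.1)
      have h1 := (hasDerivAt_id τ).mul (hc.comp τ ((hasDerivAt_id τ).const_mul ‖x‖))
      have h2 : HasDerivAt (fun τ : ℝ => τ ^ 2 • x) ((2 * τ) • x) τ := by
        simpa using (hasDerivAt_pow 2 τ).smul_const x
      have h3 := (hg.differentiable one_ne_zero _).hasFDerivAt.comp_hasDerivAt τ h2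
      refine (h1.smul h3).congr_deriv ?_
      simp only [S, hp'_def, Function.comp, id]
      rw [add_comm]
      congr 2
      ring
    rw [intervalIntegral.integral_eq_sub_of_hasDerivAt hder hSI]
    simp
  have hsplit : ∫ τ in (0 : ℝ)..1, K' 0 τ =
      (cutoffDeriv ‖x‖ * (inner ℝ x v / ‖x‖)) • g x + radialRemainder g x v := by
    have : ∀ τ, K' 0 τ = (inner ℝ x v / ‖x‖) • S τ + R τ := by
      intro τ
      simp only [K', S, R, hv, hn0, zero_smul, add_zero]
      simp only [map_sub, map_smul]
      match_scalars
      · ring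
      · ring
      · field_simp
        ring
    simp_rw [this]
    rw [intervalIntegral.integral_add (f := fun τ => (inner ℝ x v / ‖x‖) • S τ) (hSI.smul _) hRI,
      intervalIntegral.integral_smul, hS, smul_smul, mul_comm (cutoffDeriv ‖x‖), radialRemainder]
  rw [hsplit] at hmain
  simpa only [HasLineDerivAt, norm_smul_radialAverage, K, hn_def] using hmain

theorem norm_radialRemainder_le {g : E → F} (hb : ∀ x, ‖fderiv ℝ g x‖ ≤ 1 + ‖x‖) {x : E}
    (hx : x ≠ 0) (v : E) :
    ‖radialRemainder g x v‖ ≤ ‖x‖ / (2 + ‖x‖) * ‖v‖ := by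
  have hxn : ‖x‖ ≠ 0 := norm_ne_zero_iff.2 hx
  set w := v - (2 * inner ℝ x v / ‖x‖ ^ 2) • x with hw
  have hwv : ‖w‖ = ‖v‖ := by
    rw [← sq_eq_sq₀ (norm_nonneg _) (norm_nonneg _), hw, norm_sub_sq_real, inner_smul_right,
      norm_smul, mul_pow, Real.norm_eq_abs, sq_abs, real_inner_comm x v]
    field_simp
    ring
  have hpc : ContinuousOn (fun τ => cutoffDeriv (‖x‖ * τ)) (uIcc 0 1) := by
    rw [uIcc_of_le zero_le_one]
    exact continuousOn_cutoffDeriv.comp (by fun_prop) fun τ hτ => mul_nonneg (norm_nonneg x) hτ.1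
  calc ‖radialRemainder g x v‖
      ≤ ∫ τ in (0 : ℝ)..1, ‖x‖ * ‖v‖ * (cutoffDeriv (‖x‖ * τ) * τ ^ 2 * (1 + ‖x‖ * τ)) := by
        refine intervalIntegral.norm_integral_le_of_norm_le zero_le_one
          (Filter.Eventually.of_forall fun τ hτ => ?_)
          (ContinuousOn.intervalIntegrable (by fun_prop))
        have hp := cutoffDeriv_nonneg (mul_nonneg (norm_nonneg x) hτ.1.le)
        have h1 : ‖fderiv ℝ g (τ ^ 2 • x) w‖ ≤ (1 + ‖x‖ * τ) * ‖v‖ := by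
          rw [← hwv]
          refine (ContinuousLinearMap.le_opNorm _ _).trans ?_
          gcongr
          refine (hb _).trans ?_
          rw [norm_smul, Real.norm_of_nonneg (sq_nonneg τ), mul_comm]
          have : τ ^ 2 ≤ τ := by nlinarith [hτ.1, hτ.2]
          gcongr
        rw [norm_smul, Real.norm_of_nonneg (by positivity)]
        refine (mul_le_mul_of_nonneg_left h1 (by positivity)).trans_eq (by ring)
    _ = ‖x‖ * ‖v‖ * ∫ τ in (0 : ℝ)..1, cutoffDeriv (‖x‖ * τ) * τ ^ 2 * (1 + ‖x‖ * τ) :=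
        intervalIntegral.integral_const_mul _ _
    _ ≤ ‖x‖ * ‖v‖ * (1 / (2 + ‖x‖)) := by
        gcongr
        exact intervalIntegral_cutoffDeriv_le (norm_nonneg x)
    _ = _ := by ring

/-- The superlinear part of `g` in the decomposition of `exists_lipschitz_decomposition`. -/
def superlinearPart (g : E → F) (x : E) : F :=
  ‖x‖ • (((3 + ‖x‖) / ((1 + ‖x‖) * (2 + ‖x‖))) • g x - radialAverage g x)

theorem exists_hasLineDerivAt_superlinearPart [CompleteSpace F] {g : E → F}
    (hg : ContDiff ℝ 1 g) (hg0 : g 0 = 0) (hb : ∀ x, ‖fderiv ℝ g x‖ ≤ 1 + ‖x‖) (x v : E) :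
    ∃ f', HasLineDerivAt ℝ (superlinearPart g) f' x v ∧ ‖f'‖ ≤ 2 * ‖x‖ * ‖v‖ ∧
      ‖fderiv ℝ g x v - f'‖ ≤ ‖v‖ := by
  rcases eq_or_ne x 0 with rfl | hx
  · refine ⟨0, ?_, by simp, ?_⟩
    · have hc : Continuous fun x : E =>
          ((3 + ‖x‖) / ((1 + ‖x‖) * (2 + ‖x‖))) • g x - radialAverage g x := by
        have := continuous_radialAverage hg.continuous
        have := hg.continuous
        have : Continuous fun x : E => (3 + ‖x‖) / ((1 + ‖x‖) * (2 + ‖x‖)) :=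
          Continuous.div (by fun_prop) (by fun_prop) fun x => by positivity
        fun_prop
      have h0 : Filter.Tendsto (fun x : E =>
          ((3 + ‖x‖) / ((1 + ‖x‖) * (2 + ‖x‖))) • g x - radialAverage g x) (𝓝 0) (𝓝 0) := by
        simpa [hg0, radialAverage] using hc.tendsto 0
      have h1 : HasFDerivAt (superlinearPart g) (0 : E →L[ℝ] F) 0 := by
        refine HasFDerivAt.of_isLittleO ?_
        have h2 := (Asymptotics.isBigO_refl (fun x : E => ‖x‖) (𝓝 0)).smul_isLittleO
          ((Asymptotics.isLittleO_one_iff ℝ).2 h0)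
        refine (h2.congr_left (fun x => ?_)).trans_isBigO ?_
        · simp [superlinearPart]
        · simpa using (Asymptotics.isBigO_refl (fun x : E => x) (𝓝 0)).norm_left
      simpa using h1.hasLineDerivAt v
    · simpa using (ContinuousLinearMap.le_opNorm _ v).trans
        (mul_le_mul_of_nonneg_right (hb 0) (norm_nonneg v))
  · set r := ‖x‖ with hr
    have hr0 : 0 < r := norm_pos_iff.2 hx
    set a : ℝ := r * ((3 + r) / ((1 + r) * (2 + r)))
    have ha : 0 ≤ a := by positivity
    have ha' : a * (1 + r) = r * (3 + r) / (2 + r) := by simp only [a]; field_simp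
    have ha1 : a ≤ 1 := by
      simp only [a]; rw [← mul_div_assoc, div_le_one (by positivity)]; nlinarith
    have hdg : ‖fderiv ℝ g x v‖ ≤ (1 + r) * ‖v‖ := (ContinuousLinearMap.le_opNorm _ v).trans
      (mul_le_mul_of_nonneg_right (hb x) (norm_nonneg v))
    have hR := norm_radialRemainder_le hb hx v
    rw [← hr] at hR
    refine ⟨a • fderiv ℝ g x v - radialRemainder g x v, ?_, ?_, ?_⟩
    · have hn : HasDerivAt (fun s : ℝ => ‖x + s • v‖) (inner ℝ x v / r) 0 := by
        simpa using hasDerivAt_norm_add_smul (x := x) (v := v) (s := 0) (by simpa using hx)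
      have hcut : HasDerivAt (fun r : ℝ => r * ((3 + r) / ((1 + r) * (2 + r)))) (cutoffDeriv r)
          ‖x + (0 : ℝ) • v‖ := by simpa using hasDerivAt_cutoff hr0.le
      have hgl : HasDerivAt (fun s : ℝ => g (x + s • v)) (fderiv ℝ g x v) 0 :=
        (hg.differentiable one_ne_zero x).hasFDerivAt.hasLineDerivAt v
      have h1 := (hcut.comp (0 : ℝ) hn).smul hgl
      have h2 := h1.sub (hasLineDerivAt_norm_smul_radialAverage hg hx v)
      refine (h2.congr_deriv ?_).congr_of_eventuallyEq
        (Filter.Eventually.of_forall fun s => ?_)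
      · simp only [Function.comp, zero_smul, add_zero, ← hr, a]
        abel
      · simp [superlinearPart, smul_sub, smul_smul]
    · calc _ ≤ a * ((1 + r) * ‖v‖) + r / (2 + r) * ‖v‖ := by
            refine (norm_sub_le _ _).trans (add_le_add ?_ hR)
            rw [norm_smul, Real.norm_of_nonneg ha]
            gcongr
        _ = (r * (3 + r) / (2 + r) + r / (2 + r)) * ‖v‖ := by rw [← ha']; ring
        _ ≤ 2 * r * ‖v‖ := by
            gcongr
            rw [← add_div, div_le_iff₀ (by positivity)]
            nlinarith
    · have : fderiv ℝ g x v - (a • fderiv ℝ g x v - radialRemainder g x v) =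
          (1 - a) • fderiv ℝ g x v + radialRemainder g x v := by
        rw [sub_smul, one_smul]; abel
      rw [this]
      calc _ ≤ (1 - a) * ((1 + r) * ‖v‖) + r / (2 + r) * ‖v‖ := by
            refine (norm_add_le _ _).trans (add_le_add ?_ hR)
            rw [norm_smul, Real.norm_of_nonneg (sub_nonneg.2 ha1)]
            gcongr
        _ = (1 + r - r * (3 + r) / (2 + r) + r / (2 + r)) * ‖v‖ := by rw [← ha']; ring
        _ = ‖v‖ := by
            have : 1 + r - r * (3 + r) / (2 + r) + r / (2 + r) = 1 := by field_simp; ring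
            rw [this, one_mul]

/-- A `C¹` map whose differential grows at most affinely is the sum of a Lipschitz map with the
constant term as Lipschitz constant and of a map controlled by the linear term. -/
theorem exists_lipschitz_decomposition [CompleteSpace F] {g : E → F} {l₁ l₂ : ℝ} (hl₁ : 0 < l₁)
    (hl₂ : 0 < l₂) (hg : ContDiff ℝ 1 g) (hb : ∀ x, ‖fderiv ℝ g x‖ ≤ l₁ + l₂ * ‖x‖) :
    ∃ g₁ g₂ : E → F, (∀ x, g x = g₁ x + g₂ x) ∧ (∀ x y, ‖g₁ x - g₁ y‖ ≤ l₁ * ‖x - y‖) ∧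
      ∀ x y, ‖g₂ x - g₂ y‖ ≤ l₂ * ((‖x‖ + ‖y‖) * ‖x - y‖) := by
  set κ := l₁ / l₂ with hκ
  have hκ0 : 0 < κ := div_pos hl₁ hl₂
  set c := l₂ / l₁ ^ 2 with hc
  have hc0 : 0 < c := by positivity
  set G : E → F := fun y => c • (g (κ • y) - g 0)
  have hG : ContDiff ℝ 1 G := by fun_prop
  have hG0 : G 0 = 0 := by simp [G]
  have hderG : ∀ y, HasFDerivAt G ((c * κ) • fderiv ℝ g (κ • y)) y := by
    intro y
    have h1 : HasFDerivAt (fun y : E => κ • y) (κ • ContinuousLinearMap.id ℝ E) y :=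
      (hasFDerivAt_id y).const_smul κ
    have h2 := (((hg.differentiable one_ne_zero (κ • y)).hasFDerivAt.comp y h1).sub_const
      (g 0)).const_smul c
    refine h2.congr_fderiv ?_
    ext w
    simp [smul_smul]
  have hbG : ∀ y, ‖fderiv ℝ G y‖ ≤ 1 + ‖y‖ := by
    intro y
    rw [(hderG y).fderiv, norm_smul, Real.norm_of_nonneg (by positivity)]
    refine (mul_le_mul_of_nonneg_left (hb _) (by positivity)).trans_eq ?_
    rw [norm_smul, Real.norm_of_nonneg hκ0.le, hc, hκ]
    field_simp
  have h₂ := norm_sub_le_of_hasLineDerivAt (f := superlinearPart G) (C₀ := 0) zero_le_two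
    fun x v => by
      obtain ⟨f', hf', hle, -⟩ := exists_hasLineDerivAt_superlinearPart hG hG0 hbG x v
      exact ⟨f', hf', by simpa using hle⟩
  have h₁ := norm_sub_le_of_hasLineDerivAt (f := fun x => G x - superlinearPart G x) (C₀ := 1)
    le_rfl fun x v => by
      obtain ⟨f', hf', -, hle⟩ := exists_hasLineDerivAt_superlinearPart hG hG0 hbG x v
      have hGl : HasLineDerivAt ℝ G (fderiv ℝ G x v) x v :=
        (hG.differentiable one_ne_zero x).hasFDerivAt.hasLineDerivAt v
      exact ⟨_, HasDerivAt.sub hGl hf', by simpa using hle⟩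
  have hscale : ∀ x y : E, ‖κ⁻¹ • x - κ⁻¹ • y‖ = κ⁻¹ * ‖x - y‖ := fun x y => by
    rw [← smul_sub, norm_smul, Real.norm_of_nonneg (by positivity)]
  have hnorm : ∀ x : E, ‖κ⁻¹ • x‖ = κ⁻¹ * ‖x‖ := fun x => by
    rw [norm_smul, Real.norm_of_nonneg (by positivity)]
  refine ⟨fun x => g 0 + c⁻¹ • (G (κ⁻¹ • x) - superlinearPart G (κ⁻¹ • x)),
    fun x => c⁻¹ • superlinearPart G (κ⁻¹ • x), fun x => ?_, fun x y => ?_, fun x y => ?_⟩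
  · simp only [G, smul_sub, smul_smul, inv_mul_cancel₀ hc0.ne', mul_inv_cancel₀ hκ0.ne', one_smul]
    abel
  · rw [add_sub_add_left_eq_sub, ← smul_sub, norm_smul, Real.norm_of_nonneg (by positivity)]
    refine (mul_le_mul_of_nonneg_left (h₁ _ _) (by positivity)).trans_eq ?_
    rw [hscale, hc, hκ]
    field_simp
    ring
  · rw [← smul_sub, norm_smul, Real.norm_of_nonneg (by positivity)]
    refine (mul_le_mul_of_nonneg_left (h₂ _ _) (by positivity)).trans_eq ?_
    rw [hscale, hnorm, hnorm, hc, hκ]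
    field_simp
    ring

end RadialAverage

section Coupling

variable {d : ℕ} {F : Type*} [NormedAddCommGroup F]

theorem MemP2.mixMeasure {μ ν : Measure (EuclideanSpace ℝ (Fin d))} (hμ : MemP2 μ)
    (hν : MemP2 ν) {θ : ℝ} (hθ : θ ∈ Icc (0 : ℝ) 1) : MemP2 (mixMeasure θ μ ν) := by
  have := hμ.1
  have := hν.1
  refine ⟨⟨?_⟩, (hμ.2.smul_measure ENNReal.ofReal_ne_top).add_measure
    (hν.2.smul_measure ENNReal.ofReal_ne_top)⟩
  simp [_root_.mixMeasure, ← ENNReal.ofReal_add hθ.1 (sub_nonneg.2 hθ.2)]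

theorem MemP2.integrable_norm {μ : Measure (EuclideanSpace ℝ (Fin d))} (hμ : MemP2 μ) :
    Integrable (fun x => ‖x‖) μ := by
  have := hμ.1
  refine Integrable.mono' ((integrable_const (1 : ℝ)).add hμ.2) (by fun_prop)
    (Filter.Eventually.of_forall fun x => ?_)
  simp only [norm_norm, Pi.add_apply]
  nlinarith [sq_nonneg (‖x‖ - 1)]

namespace IsCoupling

variable {μ ν : Measure (EuclideanSpace ℝ (Fin d))}
  {π : Measure (EuclideanSpace ℝ (Fin d) × EuclideanSpace ℝ (Fin d))}

theorem prod [IsProbabilityMeasure μ] [IsProbabilityMeasure ν] :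
    IsCoupling (μ.prod ν) μ ν := by
  constructor <;> simp

theorem integrable_comp_fst (hπ : IsCoupling π μ ν)
    {f : EuclideanSpace ℝ (Fin d) → F}
    (hf : Integrable f μ) : Integrable (fun q => f q.1) π :=
  (hπ.1 ▸ hf : Integrable f (π.map Prod.fst)).comp_measurable measurable_fst

theorem integrable_comp_snd (hπ : IsCoupling π μ ν)
    {f : EuclideanSpace ℝ (Fin d) → F}
    (hf : Integrable f ν) : Integrable (fun q => f q.2) π :=
  (hπ.2 ▸ hf : Integrable f (π.map Prod.snd)).comp_measurable measurable_snd

theorem integral_comp_fst [NormedSpace ℝ F] (hπ : IsCoupling π μ ν)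
    {f : EuclideanSpace ℝ (Fin d) → F}
    (hf : AEStronglyMeasurable f μ) : ∫ q, f q.1 ∂π = ∫ x, f x ∂μ := by
  obtain ⟨rfl, -⟩ := hπ
  exact (integral_map measurable_fst.aemeasurable hf).symm

theorem integral_comp_snd [NormedSpace ℝ F] (hπ : IsCoupling π μ ν)
    {f : EuclideanSpace ℝ (Fin d) → F}
    (hf : AEStronglyMeasurable f ν) : ∫ q, f q.2 ∂π = ∫ x, f x ∂ν := by
  obtain ⟨-, rfl⟩ := hπ
  exact (integral_map measurable_snd.aemeasurable hf).symm

theorem norm_integral_sub_integral_le [NormedSpace ℝ F] (hπ : IsCoupling π μ ν)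
    {f : EuclideanSpace ℝ (Fin d) → F} (hfμ : Integrable f μ) (hfν : Integrable f ν)
    {b : EuclideanSpace ℝ (Fin d) × EuclideanSpace ℝ (Fin d) → ℝ} (hb : Integrable b π)
    (hfb : ∀ q, ‖f q.1 - f q.2‖ ≤ b q) :
    ‖∫ x, f x ∂μ - ∫ x, f x ∂ν‖ ≤ ∫ q, b q ∂π := by
  rw [← hπ.integral_comp_fst hfμ.1, ← hπ.integral_comp_snd hfν.1,
    ← integral_sub (hπ.integrable_comp_fst hfμ) (hπ.integrable_comp_snd hfν)]
  exact norm_integral_le_of_norm_le hb (Filter.Eventually.of_forall hfb)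

theorem integrable_norm_sub (hπ : IsCoupling π μ ν) (hμ : MemP2 μ) (hν : MemP2 ν) :
    Integrable (fun q => ‖q.1 - q.2‖) π := by
  refine Integrable.mono' ((hπ.integrable_comp_fst hμ.integrable_norm).add
    (hπ.integrable_comp_snd hν.integrable_norm)) (by fun_prop)
    (Filter.Eventually.of_forall fun q => ?_)
  simpa using norm_sub_le q.1 q.2

theorem integrable_norm_sub_sq (hπ : IsCoupling π μ ν) (hμ : MemP2 μ) (hν : MemP2 ν) :
    Integrable (fun q => ‖q.1 - q.2‖ ^ 2) π := by
  refine Integrable.mono' (((hπ.integrable_comp_fst hμ.2).add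
    (hπ.integrable_comp_snd hν.2)).const_mul 2) (by fun_prop)
    (Filter.Eventually.of_forall fun q => ?_)
  simp only [norm_pow, norm_norm, Pi.add_apply]
  nlinarith [norm_sub_le q.1 q.2, norm_nonneg (q.1 - q.2), sq_nonneg (‖q.1‖ - ‖q.2‖)]

end IsCoupling

/-- The Cauchy–Schwarz inequality for real functions, in terms of real powers. -/
theorem integral_mul_le_rpow_mul_rpow {α : Type*} [MeasurableSpace α] {π : Measure α} {f g : α → ℝ}
    (hf0 : ∀ a, 0 ≤ f a) (hg0 : ∀ a, 0 ≤ g a) (hf : AEStronglyMeasurable f π)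
    (hg : AEStronglyMeasurable g π) (hf2 : Integrable (fun a => f a ^ 2) π)
    (hg2 : Integrable (fun a => g a ^ 2) π) :
    Integrable (fun a => f a * g a) π ∧ ∫ a, f a * g a ∂π ≤
      (∫ a, f a ^ (2 : ℝ) ∂π) ^ (1 / (2 : ℝ)) * (∫ a, g a ^ (2 : ℝ) ∂π) ^ (1 / (2 : ℝ)) := by
  have hfL := (memLp_two_iff_integrable_sq hf).2 hf2
  have hgL := (memLp_two_iff_integrable_sq hg).2 hg2
  refine ⟨hfL.integrable_mul hgL, ?_⟩
  have h2 : ENNReal.ofReal 2 = 2 := by simp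
  exact integral_mul_le_Lp_mul_Lq_of_nonneg Real.HolderConjugate.two_two
    (Filter.Eventually.of_forall hf0) (Filter.Eventually.of_forall hg0)
    (by rwa [h2]) (by rwa [h2])

variable {μ ν : Measure (EuclideanSpace ℝ (Fin d))}

theorem momentNorm_nonneg (p : ℝ) (μ : Measure (EuclideanSpace ℝ (Fin d))) :
    0 ≤ momentNorm p μ :=
  Real.rpow_nonneg (integral_nonneg fun _ => Real.rpow_nonneg (norm_nonneg _) _) _

/-- A bound by every transport cost passes to the Wasserstein distance. -/
theorem le_mul_wassersteinDist (hμ : MemP2 μ) (hν : MemP2 ν) {p B c : ℝ} (hc : 0 ≤ c)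
    (h : ∀ π : Measure (EuclideanSpace ℝ (Fin d) × EuclideanSpace ℝ (Fin d)),
      IsProbabilityMeasure π → IsCoupling π μ ν →
        B ≤ c * (∫ q, ‖q.1 - q.2‖ ^ p ∂π) ^ (1 / p)) :
    B ≤ c * wassersteinDist p μ ν := by
  have := hμ.1
  have := hν.1
  rcases hc.eq_or_lt with rfl | hc
  · simpa using h _ inferInstance IsCoupling.prod
  · rw [mul_comm, ← div_le_iff₀ hc]
    refine le_csInf ⟨_, μ.prod ν, inferInstance, IsCoupling.prod, rfl⟩ ?_
    rintro r ⟨π, hP, hπ, rfl⟩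
    rw [div_le_iff₀ hc, mul_comm]
    exact h π hP hπ

theorem norm_integral_sub_integral_le_wassersteinDist_one [NormedSpace ℝ F]
    (hμ : MemP2 μ) (hν : MemP2 ν)
    {f : EuclideanSpace ℝ (Fin d) → F} {C : ℝ} (hC : 0 ≤ C) (hfμ : Integrable f μ)
    (hfν : Integrable f ν) (hf : ∀ x y, ‖f x - f y‖ ≤ C * ‖x - y‖) :
    ‖∫ x, f x ∂μ - ∫ x, f x ∂ν‖ ≤ C * wassersteinDist 1 μ ν := by
  refine le_mul_wassersteinDist hμ hν hC fun π _ hπ => ?_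
  simp only [Real.rpow_one, div_one]
  rw [← integral_const_mul]
  exact hπ.norm_integral_sub_integral_le hfμ hfν ((hπ.integrable_norm_sub hμ hν).const_mul C)
    fun q => hf q.1 q.2

theorem norm_integral_sub_integral_le_wassersteinDist_two [NormedSpace ℝ F]
    (hμ : MemP2 μ) (hν : MemP2 ν)
    {f : EuclideanSpace ℝ (Fin d) → F} {C : ℝ} (hC : 0 ≤ C) (hfμ : Integrable f μ)
    (hfν : Integrable f ν) (hf : ∀ x y, ‖f x - f y‖ ≤ C * ((‖x‖ + ‖y‖) * ‖x - y‖)) :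
    ‖∫ x, f x ∂μ - ∫ x, f x ∂ν‖ ≤
      C * (momentNorm 2 μ + momentNorm 2 ν) * wassersteinDist 2 μ ν := by
  have hm := add_nonneg (momentNorm_nonneg 2 μ) (momentNorm_nonneg 2 ν)
  refine le_mul_wassersteinDist hμ hν (mul_nonneg hC hm) fun π _ hπ => ?_
  have hsq := hπ.integrable_norm_sub_sq hμ hν
  obtain ⟨hi₁, h₁⟩ := integral_mul_le_rpow_mul_rpow (π := π) (f := fun q => ‖q.1‖)
    (g := fun q => ‖q.1 - q.2‖) (fun _ => norm_nonneg _) (fun _ => norm_nonneg _) (by fun_prop)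
    (by fun_prop) (hπ.integrable_comp_fst hμ.2) hsq
  obtain ⟨hi₂, h₂⟩ := integral_mul_le_rpow_mul_rpow (π := π) (f := fun q => ‖q.2‖)
    (g := fun q => ‖q.1 - q.2‖) (fun _ => norm_nonneg _) (fun _ => norm_nonneg _) (by fun_prop)
    (by fun_prop) (hπ.integrable_comp_snd hν.2) hsq
  have hmeas : Measurable fun x : EuclideanSpace ℝ (Fin d) => ‖x‖ ^ (2 : ℝ) := by fun_prop
  rw [hπ.integral_comp_fst (f := fun x => ‖x‖ ^ (2 : ℝ)) hmeas.aestronglyMeasurable] at h₁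
  rw [hπ.integral_comp_snd (f := fun x => ‖x‖ ^ (2 : ℝ)) hmeas.aestronglyMeasurable] at h₂
  refine (hπ.norm_integral_sub_integral_le hfμ hfν ((hi₁.add hi₂).const_mul C) fun q =>
    (hf q.1 q.2).trans_eq (by simp only [Pi.add_apply, add_mul])).trans ?_
  rw [integral_const_mul, integral_add' hi₁ hi₂, mul_assoc, add_mul]
  exact mul_le_mul_of_nonneg_left (add_le_add h₁ h₂) hC

theorem MemP2.integrable_of_norm_sub_le (hμ : MemP2 μ) {f : EuclideanSpace ℝ (Fin d) → F}
    (hf : Continuous f) {C₁ C₂ : ℝ}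
    (hb : ∀ x, ‖f x - f 0‖ ≤ C₁ * ‖x‖ + C₂ * ‖x‖ ^ 2) : Integrable f μ := by
  have := hμ.1
  refine Integrable.mono' (((hμ.integrable_norm.const_mul C₁).add (hμ.2.const_mul C₂)).add
    (integrable_const ‖f 0‖)) hf.aestronglyMeasurable (Filter.Eventually.of_forall fun x => ?_)
  have := norm_add_le (f x - f 0) (f 0)
  rw [sub_add_cancel] at this
  exact this.trans (add_le_add_left (hb x) _)

/-- The difference of the integrals of a `C¹` map with affinely growing differential, with a
separate optimal coupling for each of the two terms. -/
theorem norm_integral_sub_integral_le_of_fderiv_le [NormedSpace ℝ F] [CompleteSpace F]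
    (hμ : MemP2 μ) (hν : MemP2 ν)
    {f : EuclideanSpace ℝ (Fin d) → F} {l₁ l₂ : ℝ} (hl₁ : 0 ≤ l₁) (hl₂ : 0 ≤ l₂)
    (hf : ContDiff ℝ 1 f) (hb : ∀ x, ‖fderiv ℝ f x‖ ≤ l₁ + l₂ * ‖x‖) :
    ‖∫ x, f x ∂μ - ∫ x, f x ∂ν‖ ≤ l₁ * wassersteinDist 1 μ ν +
      l₂ * (momentNorm 2 μ + momentNorm 2 ν) * wassersteinDist 2 μ ν := by
  have hpos : ∀ ε > 0, ‖∫ x, f x ∂μ - ∫ x, f x ∂ν‖ ≤ (l₁ + ε) * wassersteinDist 1 μ ν +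
      (l₂ + ε) * (momentNorm 2 μ + momentNorm 2 ν) * wassersteinDist 2 μ ν := by
    intro ε hε
    obtain ⟨f₁, f₂, hadd, h₁, h₂⟩ := exists_lipschitz_decomposition (l₁ := l₁ + ε) (l₂ := l₂ + ε)
      (by positivity) (by positivity) hf fun x => (hb x).trans (by gcongr <;> linarith)
    have hc₁ : Continuous f₁ := by
      refine (LipschitzWith.of_dist_le_mul (K := (l₁ + ε).toNNReal) fun x y => ?_).continuous
      rw [Real.coe_toNNReal _ (by positivity), dist_eq_norm, dist_eq_norm]
      exact h₁ x y
    have hc₂ : Continuous f₂ := by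
      have : f₂ = fun x => f x - f₁ x := funext fun x => by rw [hadd x, add_sub_cancel_left]
      rw [this]
      exact hf.continuous.sub hc₁
    have hi₁ : ∀ ρ : Measure (EuclideanSpace ℝ (Fin d)), MemP2 ρ → Integrable f₁ ρ := fun ρ hρ =>
      hρ.integrable_of_norm_sub_le hc₁ (C₁ := l₁ + ε) (C₂ := 0) fun x => by simpa using h₁ x 0
    have hi₂ : ∀ ρ : Measure (EuclideanSpace ℝ (Fin d)), MemP2 ρ → Integrable f₂ ρ := fun ρ hρ =>
      hρ.integrable_of_norm_sub_le hc₂ (C₁ := 0) (C₂ := l₂ + ε) fun x => by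
        simpa [sq] using h₂ x 0
    simp only [hadd]
    rw [integral_add (hi₁ μ hμ) (hi₂ μ hμ), integral_add (hi₁ ν hν) (hi₂ ν hν), add_sub_add_comm]
    exact (norm_add_le _ _).trans (add_le_add
      (norm_integral_sub_integral_le_wassersteinDist_one hμ hν (by positivity) (hi₁ μ hμ)
        (hi₁ ν hν) h₁)
      (norm_integral_sub_integral_le_wassersteinDist_two hμ hν (by positivity) (hi₂ μ hμ)
        (hi₂ ν hν) h₂))
  have hlim : Filter.Tendsto (fun ε : ℝ => (l₁ + ε) * wassersteinDist 1 μ ν +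
      (l₂ + ε) * (momentNorm 2 μ + momentNorm 2 ν) * wassersteinDist 2 μ ν) (𝓝[>] 0)
      (𝓝 (l₁ * wassersteinDist 1 μ ν +
        l₂ * (momentNorm 2 μ + momentNorm 2 ν) * wassersteinDist 2 μ ν)) := by
    refine Filter.Tendsto.mono_left (Continuous.tendsto' (by fun_prop) _ _ (by simp))
      nhdsWithin_le_nhds
  exact ge_of_tendsto hlim (by filter_upwards [self_mem_nhdsWithin] with ε hε using hpos ε hε)

end Coupling

end LipschitzEstimates

/-- If `h : P₂(ℝ^d) → ℝ^l` has a linear functional derivative `D` such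
that `x̃ ↦ D(μ)(x̃)` is continuously differentiable with
`|∂_x̃ D(μ)(x̃)| ≤ l₁ + l₂|x̃|`, then
`|h(μ) − h(μ')| ≤ l₁ W₁(μ,μ') + l₂(‖μ‖₂ + ‖μ'‖₂) W₂(μ,μ')`; in particular, when
`l₂ = 0`, `|h(μ) − h(μ')| ≤ l₁ W₁(μ,μ')`. -/
theorem statement0 (d l : ℕ) (hd : 0 < d) (hl : 0 < l) (l₁ l₂ : ℝ)
    (hl₁ : 0 ≤ l₁) (hl₂ : 0 ≤ l₂)
    (h : Measure (EuclideanSpace ℝ (Fin d)) → EuclideanSpace ℝ (Fin l))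
    (D : Measure (EuclideanSpace ℝ (Fin d)) → EuclideanSpace ℝ (Fin d) →
      EuclideanSpace ℝ (Fin l))
    (hD : HasLFD h D)
    (hsmooth : ∀ μ, MemP2 μ → ContDiff ℝ 1 (D μ))
    (hbound : ∀ μ, MemP2 μ → ∀ x, ‖fderiv ℝ (D μ) x‖ ≤ l₁ + l₂ * ‖x‖) :
    ∀ μ μ', MemP2 μ → MemP2 μ' →
      (‖h μ - h μ'‖ ≤ l₁ * wassersteinDist 1 μ μ' +
        l₂ * (momentNorm 2 μ + momentNorm 2 μ') * wassersteinDist 2 μ μ') ∧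
      (l₂ = 0 → ‖h μ - h μ'‖ ≤ l₁ * wassersteinDist 1 μ μ') := by
  intro μ μ' hμ hμ'
  have key : ‖h μ - h μ'‖ ≤ l₁ * wassersteinDist 1 μ μ' +
      l₂ * (momentNorm 2 μ + momentNorm 2 μ') * wassersteinDist 2 μ μ' := by
    rw [hD.2 μ μ' hμ hμ']
    refine (intervalIntegral.norm_integral_le_of_norm_le_const fun θ hθ => ?_).trans_eq
      (by rw [sub_zero, abs_one, mul_one])
    rw [Set.uIoc_of_le zero_le_one] at hθ
    have hmix := hμ.mixMeasure hμ' ⟨hθ.1.le, hθ.2⟩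
    exact norm_integral_sub_integral_le_of_fderiv_le hμ hμ' hl₁ hl₂ (hsmooth _ hmix)
      (hbound _ hmix)
  refine ⟨key, fun h0 => ?_⟩
  simpa [h0] using key

end
end

section
/- Let t < T, let u, v : [t,T] → ℝ^n be continuously differentiable, and let λ_k, λ_x, λ_z, Λ_k, c₁, c₂ be strictly positive constants such that: (i) v(T)·u(T) ≥ λ_k |u(T)|²; (ii) for all s ∈ [t,T], (d/ds)(v(s)·u(s)) ≤ −λ_z |v(s)|² − λ_x |u(s)|²; and (iii) |v(t)|² ≤ Λ_k² |u(T)|² + ∫_t^T (c₁ |u(s)|² + c₂ |v(s)|²) ds. Then |v(t)| ≤ max{Λ_k²/λ_k, c₁/λ_x, c₂/λ_z} · |u(t)|. -/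
open scoped RealInnerProductSpace

/-- The abstract forward–backward estimate at the core of the crucial
a priori bound: if `v(T)·u(T) ≥ λ_k|u(T)|²`, the derivative of `s ↦ v(s)·u(s)` is at most
`−λ_z|v|² − λ_x|u|²` on `[t,T]`, and
`|v(t)|² ≤ Λ_k²|u(T)|² + ∫ₜᵀ (c₁|u|² + c₂|v|²)`, then
`|v(t)| ≤ max{Λ_k²/λ_k, c₁/λ_x, c₂/λ_z}·|u(t)|`. -/
theorem statement12 (n : ℕ) (t T : ℝ) (htT : t < T)
    (u v u' v' : ℝ → EuclideanSpace ℝ (Fin n))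
    (hu : ∀ s ∈ Set.Icc t T, HasDerivWithinAt u (u' s) (Set.Icc t T) s)
    (hv : ∀ s ∈ Set.Icc t T, HasDerivWithinAt v (v' s) (Set.Icc t T) s)
    (hu' : ContinuousOn u' (Set.Icc t T)) (hv' : ContinuousOn v' (Set.Icc t T))
    (lamk lamx lamz Lamk c₁ c₂ : ℝ)
    (hlamk : 0 < lamk) (hlamx : 0 < lamx) (hlamz : 0 < lamz)
    (hLamk : 0 < Lamk) (hc₁ : 0 < c₁) (hc₂ : 0 < c₂)
    (h1 : lamk * ‖u T‖ ^ 2 ≤ ⟪v T, u T⟫)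
    (h2 : ∀ s ∈ Set.Icc t T,
      ⟪v' s, u s⟫ + ⟪v s, u' s⟫ ≤ -lamz * ‖v s‖ ^ 2 - lamx * ‖u s‖ ^ 2)
    (h3 : ‖v t‖ ^ 2 ≤ Lamk ^ 2 * ‖u T‖ ^ 2 +
      ∫ s in t..T, (c₁ * ‖u s‖ ^ 2 + c₂ * ‖v s‖ ^ 2)) :
    ‖v t‖ ≤ max (max (Lamk ^ 2 / lamk) (c₁ / lamx)) (c₂ / lamz) * ‖u t‖ := by
  set M := max (max (Lamk ^ 2 / lamk) (c₁ / lamx)) (c₂ / lamz)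
  have hMk : Lamk ^ 2 ≤ M * lamk :=
    (div_le_iff₀ hlamk).1 ((le_max_left _ _).trans (le_max_left _ _))
  have hMx : c₁ ≤ M * lamx :=
    (div_le_iff₀ hlamx).1 ((le_max_right _ _).trans (le_max_left _ _))
  have hMz : c₂ ≤ M * lamz := (div_le_iff₀ hlamz).1 (le_max_right _ _)
  have hM : 0 < M := lt_of_lt_of_le (div_pos hc₂ hlamz) (le_max_right _ _)
  have hcu : ContinuousOn u (Set.Icc t T) := fun s hs => (hu s hs).continuousWithinAt
  have hcv : ContinuousOn v (Set.Icc t T) := fun s hs => (hv s hs).continuousWithinAt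
  have hd : ∀ s ∈ Set.Icc t T, HasDerivWithinAt (fun r => ⟪v r, u r⟫)
      (⟪v s, u' s⟫ + ⟪v' s, u s⟫) (Set.Icc t T) s :=
    fun s hs => (hv s hs).inner ℝ (hu s hs)
  have hint : IntervalIntegrable (fun s => ⟪v s, u' s⟫ + ⟪v' s, u s⟫)
      MeasureTheory.volume t T :=
    ((hcv.inner hu').add (hv'.inner hcu)).intervalIntegrable_of_Icc htT.le
  have hftc : ∫ s in t..T, (⟪v s, u' s⟫ + ⟪v' s, u s⟫) = ⟪v T, u T⟫ - ⟪v t, u t⟫ :=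
    intervalIntegral.integral_eq_sub_of_hasDerivAt_of_le htT.le (hcv.inner hcu)
      (fun s hs => (hd s (Set.Ioo_subset_Icc_self hs)).hasDerivAt (Icc_mem_nhds hs.1 hs.2)) hint
  have hint' : IntervalIntegrable (fun s => c₁ * ‖u s‖ ^ 2 + c₂ * ‖v s‖ ^ 2)
      MeasureTheory.volume t T :=
    (((hcu.norm.pow 2).const_mul c₁).add
      ((hcv.norm.pow 2).const_mul c₂)).intervalIntegrable_of_Icc htT.le
  have hmono : ∫ s in t..T, (c₁ * ‖u s‖ ^ 2 + c₂ * ‖v s‖ ^ 2) ≤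
      ∫ s in t..T, -M * (⟪v s, u' s⟫ + ⟪v' s, u s⟫) := by
    refine intervalIntegral.integral_mono_on htT.le hint' (hint.const_mul _) fun s hs => ?_
    have hdrift := mul_le_mul_of_nonneg_left (h2 s hs) hM.le
    have hx := mul_le_mul_of_nonneg_right hMx (sq_nonneg ‖u s‖)
    have hz := mul_le_mul_of_nonneg_right hMz (sq_nonneg ‖v s‖)
    linarith
  rw [intervalIntegral.integral_const_mul, hftc] at hmono
  have hterm := mul_le_mul_of_nonneg_left h1 hM.le
  have hk := mul_le_mul_of_nonneg_right hMk (sq_nonneg ‖u T‖)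
  have hcs := mul_le_mul_of_nonneg_left (real_inner_le_norm (v t) (u t)) hM.le
  have hsq : ‖v t‖ * ‖v t‖ ≤ ‖v t‖ * (M * ‖u t‖) := by linarith
  rcases (norm_nonneg (v t)).eq_or_lt with h0 | hpos
  · rw [← h0]
    positivity
  · exact le_of_mul_le_mul_left hsq hpos
end

section
/- Let n, m, d be positive integers, U ⊆ ℝ^n × ℝ^d open, f : ℝ^n × ℝ^m → ℝ^d and g : ℝ^n × ℝ^m → ℝ twice continuously differentiable, and α̂ : U → ℝ^m differentiable, satisfying the first-order condition (D_α f(x, α̂(x,z)))ᵀ z + ∇_α g(x, α̂(x,z)) = 0 for all (x,z) ∈ U, where D_α f(x,α) ∈ ℝ^{d×m} is the Jacobian of f in α and ∇_α g(x,α) ∈ ℝ^m the gradient of g in α. For (x,z) ∈ U set H(x,z) := ∑_{j=1}^d z_j ∇²_{αα} f_j(x, α̂(x,z)) + ∇²_{αα} g(x, α̂(x,z)) ∈ ℝ^{m×m} and M(x,z) := ∂_x[(D_α f)ᵀ z + ∇_α g](x, α̂(x,z)) ∈ ℝ^{m×n} (the mixed second derivative in x of the first-order-condition map, evaluated at α =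 α̂(x,z), not differentiating through α̂). Then for all (x,z) ∈ U: M(x,z) + H(x,z) ∂_x α̂(x,z) = 0, (D_α f(x, α̂(x,z)))ᵀ + H(x,z) ∂_z α̂(x,z) = 0, and consequently D_α f(x, α̂(x,z)) · ∂_x α̂(x,z) = (∂_z α̂(x,z))ᵀ · M(x,z). -/
open scoped RealInnerProductSpace

section Helpers

variable {E A Z : Type*} [NormedAddCommGroup E] [NormedSpace ℝ E]
  [NormedAddCommGroup A] [InnerProductSpace ℝ A] [CompleteSpace A]
  [NormedAddCommGroup Z] [InnerProductSpace ℝ Z] [CompleteSpace Z]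

/-- The adjoint of real operators, as a continuous linear map. -/
noncomputable def realAdjointCLM (A Z : Type*)
    [NormedAddCommGroup A] [InnerProductSpace ℝ A] [CompleteSpace A]
    [NormedAddCommGroup Z] [InnerProductSpace ℝ Z] [CompleteSpace Z] :
    (A →L[ℝ] Z) →L[ℝ] (Z →L[ℝ] A) where
  toFun T := ContinuousLinearMap.adjoint T
  map_add' S T := by simp
  map_smul' c T := by simp
  cont := (ContinuousLinearMap.adjoint (𝕜 := ℝ) (E := A) (F := Z)).continuous

/-- The inverse of the Riesz isomorphism of a real Hilbert space, as a continuous linear map. -/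
noncomputable def realRieszCLM (A : Type*)
    [NormedAddCommGroup A] [InnerProductSpace ℝ A] [CompleteSpace A] :
    (A →L[ℝ] ℝ) →L[ℝ] A where
  toFun T := (InnerProductSpace.toDual ℝ A).symm T
  map_add' S T := by simp
  map_smul' c T := by simp
  cont := (InnerProductSpace.toDual ℝ A).symm.continuous

theorem ContDiff.differentiable_partial_fderiv {B F : Type*} [NormedAddCommGroup B]
    [NormedSpace ℝ B] [NormedAddCommGroup F] [NormedSpace ℝ F] {f : E → B → F}
    (hf : ContDiff ℝ 2 (fun p : E × B => f p.1 p.2)) :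
    Differentiable ℝ (fun p : E × B => fderiv ℝ (fun α => f p.1 α) p.2) := by
  have h : ContDiff ℝ 1 (fun p : E × B => fderiv ℝ (f p.1) p.2) := by
    refine ContDiff.fderiv (m := 2) (n := 1) ?_ contDiff_snd (by norm_num)
    exact hf.comp ((contDiff_fst.comp contDiff_fst).prodMk contDiff_snd)
  exact h.differentiable (by norm_num)

theorem ContDiff.differentiable_partial_gradient {g : E → A → ℝ}
    (hg : ContDiff ℝ 2 (fun p : E × A => g p.1 p.2)) :
    Differentiable ℝ (fun p : E × A => gradient (fun α => g p.1 α) p.2) :=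
  (realRieszCLM A).differentiable.comp hg.differentiable_partial_fderiv

theorem ContDiff.differentiable_gradient {φ : A → ℝ} (hφ : ContDiff ℝ 2 φ) :
    Differentiable ℝ (gradient φ) :=
  (realRieszCLM A).differentiable.comp
    ((hφ.fderiv_right (m := 1) (by norm_num)).differentiable (by norm_num))

theorem ContDiff.adjoint_fderiv_gradient {φ : A → ℝ} (hφ : ContDiff ℝ 2 φ) (a : A) :
    ContinuousLinearMap.adjoint (fderiv ℝ (gradient φ) a) = fderiv ℝ (gradient φ) a := by
  have hd : DifferentiableAt ℝ (fderiv ℝ φ) a :=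
    (hφ.fderiv_right (m := 1) (by norm_num)).differentiable (by norm_num) a
  have h : fderiv ℝ (gradient φ) a = (realRieszCLM A).comp (fderiv ℝ (fderiv ℝ φ) a) :=
    ((realRieszCLM A).hasFDerivAt.comp a hd.hasFDerivAt).fderiv
  have key : ∀ u v, ⟪fderiv ℝ (gradient φ) a u, v⟫ = fderiv ℝ (fderiv ℝ φ) a u v := by
    intro u v
    rw [h]
    exact InnerProductSpace.toDual_symm_apply
  have hs : IsSymmSndFDerivAt ℝ φ a := hφ.contDiffAt.isSymmSndFDerivAt (by simp)
  refine ((ContinuousLinearMap.eq_adjoint_iff _ _).2 fun u v => ?_).symm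
  rw [key, real_inner_comm, key, hs.eq]

theorem gradient_add_of_differentiableAt {φ ψ : A → ℝ} {a : A}
    (hφ : DifferentiableAt ℝ φ a) (hψ : DifferentiableAt ℝ ψ a) :
    gradient (fun α => φ α + ψ α) a = gradient φ a + gradient ψ a := by
  have h := fderiv_add hφ hψ
  exact (congrArg (realRieszCLM A) h).trans (map_add _ _ _)

theorem adjoint_fderiv_apply {f : A → Z} {a : A} (hf : DifferentiableAt ℝ f a) (z : Z) :
    ContinuousLinearMap.adjoint (fderiv ℝ f a) z = gradient (fun α => ⟪z, f α⟫) a := by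
  refine ext_inner_right ℝ fun v => ?_
  rw [ContinuousLinearMap.adjoint_inner_left, gradient, InnerProductSpace.toDual_symm_apply,
    fderiv_inner_apply ℝ (differentiableAt_const z) hf]
  simp

theorem adjoint_fderiv_apply_eq_sum {d : ℕ} {f : A → EuclideanSpace ℝ (Fin d)} {a : A}
    (hf : DifferentiableAt ℝ f a) (z : EuclideanSpace ℝ (Fin d)) :
    ContinuousLinearMap.adjoint (fderiv ℝ f a) z =
      ∑ j, z j • gradient (fun α => f α j) a := by
  refine ext_inner_right ℝ fun v => ?_
  have hj : ∀ j, fderiv ℝ (fun α => f α j) a v = fderiv ℝ f a v j := fun j => by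
    have := ((EuclideanSpace.proj (𝕜 := ℝ) j).hasFDerivAt.comp a hf.hasFDerivAt).fderiv
    exact congrArg (fun T => T v) this
  rw [ContinuousLinearMap.adjoint_inner_left, sum_inner, PiLp.inner_apply]
  refine Finset.sum_congr rfl fun j _ => ?_
  rw [real_inner_smul_left, gradient, InnerProductSpace.toDual_symm_apply, hj]
  simp [mul_comm]

theorem fderiv_add_comp_fderiv_eq_zero {V W Y : Type*} [NormedAddCommGroup V] [NormedSpace ℝ V]
    [NormedAddCommGroup W] [NormedSpace ℝ W] [NormedAddCommGroup Y] [NormedSpace ℝ Y]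
    {Φ : V × W → Y} {β : V → W} {x : V}
    (hΦ : DifferentiableAt ℝ Φ (x, β x)) (hβ : DifferentiableAt ℝ β x)
    (h : ∀ᶠ x' in nhds x, Φ (x', β x') = 0) :
    fderiv ℝ (fun x' => Φ (x', β x)) x +
      (fderiv ℝ (fun w => Φ (x, w)) (β x)).comp (fderiv ℝ β x) = 0 := by
  have hx := HasFDerivAt.comp (f := fun x' => (x', β x)) x hΦ.hasFDerivAt
    (hasFDerivAt_prodMk_left x (β x))
  have hw := HasFDerivAt.comp (f := fun w => (x, w)) (β x) hΦ.hasFDerivAt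
    (hasFDerivAt_prodMk_right x (β x))
  have hc := HasFDerivAt.comp (f := fun x' => (x', β x')) x hΦ.hasFDerivAt
    ((hasFDerivAt_id x).prodMk hβ.hasFDerivAt)
  have he := hc.unique ((hasFDerivAt_const (0 : Y) x).congr_of_eventuallyEq h)
  simp only [Function.comp_def] at hx hw
  rw [hx.fderiv, hw.fderiv, ← he]
  ext1 v
  simp [← map_add]

theorem clm_add_comp_fderiv_eq_zero {V W Y : Type*} [NormedAddCommGroup V] [NormedSpace ℝ V]
    [NormedAddCommGroup W] [NormedSpace ℝ W] [NormedAddCommGroup Y] [NormedSpace ℝ Y]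
    {C : W → V →L[ℝ] Y} {G : W → Y} {β : V → W} {z : V}
    (hC : DifferentiableAt ℝ C (β z)) (hG : DifferentiableAt ℝ G (β z))
    (hβ : DifferentiableAt ℝ β z)
    (h : ∀ᶠ z' in nhds z, C (β z') z' + G (β z') = 0) :
    C (β z) + (fderiv ℝ (fun w => C w z + G w) (β z)).comp (fderiv ℝ β z) = 0 := by
  have hw := (hC.hasFDerivAt.clm_apply (hasFDerivAt_const z (β z))).fun_add hG.hasFDerivAt
  have hCβ := HasFDerivAt.comp z hC.hasFDerivAt hβ.hasFDerivAt
  have hGβ := HasFDerivAt.comp z hG.hasFDerivAt hβ.hasFDerivAt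
  have hc := (hCβ.clm_apply (hasFDerivAt_id z)).add hGβ
  have he := hc.unique ((hasFDerivAt_const (0 : Y) z).congr_of_eventuallyEq h)
  rw [hw.fderiv, ← he]
  ext1 v
  simp [add_assoc]

end Helpers

/-- Differentiating the first-order condition
`(D_αf(x,α̂(x,z)))ᵀz + ∇_αg(x,α̂(x,z)) = 0` in `x` and in `z` yields the identities
`M + H∂ₓα̂ = 0`, `(D_αf)ᵀ + H∂_zα̂ = 0`, and the cancellation identity
`D_αf·∂ₓα̂ = (∂_zα̂)ᵀ·M`, where
`H(x,z) = ∑ⱼ zⱼ∇²_{αα}fⱼ + ∇²_{αα}g` and `M(x,z)` is the mixed second derivative in `x`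
of the first-order-condition map, both evaluated at `α = α̂(x,z)`. -/
theorem statement13 (n m d : ℕ)
    (U : Set (EuclideanSpace ℝ (Fin n) × EuclideanSpace ℝ (Fin d))) (hU : IsOpen U)
    (f : EuclideanSpace ℝ (Fin n) → EuclideanSpace ℝ (Fin m) → EuclideanSpace ℝ (Fin d))
    (g : EuclideanSpace ℝ (Fin n) → EuclideanSpace ℝ (Fin m) → ℝ)
    (hf : ContDiff ℝ 2 (fun p : EuclideanSpace ℝ (Fin n) × EuclideanSpace ℝ (Fin m) =>
      f p.1 p.2))
    (hg : ContDiff ℝ 2 (fun p : EuclideanSpace ℝ (Fin n) × EuclideanSpace ℝ (Fin m) =>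
      g p.1 p.2))
    (αhat : EuclideanSpace ℝ (Fin n) × EuclideanSpace ℝ (Fin d) → EuclideanSpace ℝ (Fin m))
    (hαhat : DifferentiableOn ℝ αhat U)
    (hFOC : ∀ p ∈ U,
      ContinuousLinearMap.adjoint (fderiv ℝ (fun α => f p.1 α) (αhat p)) p.2 +
        gradient (fun α => g p.1 α) (αhat p) = 0) :
    ∀ x z, (x, z) ∈ U →
      (fderiv ℝ (fun x' =>
          ContinuousLinearMap.adjoint (fderiv ℝ (fun α => f x' α) (αhat (x, z))) z +
            gradient (fun α => g x' α) (αhat (x, z))) x +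
        ((∑ j : Fin d, z j • fderiv ℝ (gradient fun α => f x α j) (αhat (x, z))) +
            fderiv ℝ (gradient fun α => g x α) (αhat (x, z))).comp
          (fderiv ℝ (fun x' => αhat (x', z)) x) = 0) ∧
      (ContinuousLinearMap.adjoint (fderiv ℝ (fun α => f x α) (αhat (x, z))) +
        ((∑ j : Fin d, z j • fderiv ℝ (gradient fun α => f x α j) (αhat (x, z))) +
            fderiv ℝ (gradient fun α => g x α) (αhat (x, z))).comp
          (fderiv ℝ (fun z' => αhat (x, z')) z) = 0) ∧
      ((fderiv ℝ (fun α => f x α) (αhat (x, z))).comp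
          (fderiv ℝ (fun x' => αhat (x', z)) x) =
        (ContinuousLinearMap.adjoint (fderiv ℝ (fun z' => αhat (x, z')) z)).comp
          (fderiv ℝ (fun x' =>
            ContinuousLinearMap.adjoint (fderiv ℝ (fun α => f x' α) (αhat (x, z))) z +
              gradient (fun α => g x' α) (αhat (x, z))) x)) := by
  intro x z hxz
  have hU' : U ∈ nhds (x, z) := hU.mem_nhds hxz
  have hα : DifferentiableAt ℝ αhat (x, z) := (hαhat _ hxz).differentiableAt hU'
  set a := αhat (x, z)
  have hfx : ContDiff ℝ 2 (fun α => f x α) := hf.comp (contDiff_prodMk_right x)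
  have hgx : ContDiff ℝ 2 (fun α => g x α) := hg.comp (contDiff_prodMk_right x)
  have hfj : ∀ j, ContDiff ℝ 2 (fun α => f x α j) := fun j =>
    (EuclideanSpace.proj (𝕜 := ℝ) j).contDiff.comp hfx
  have hfd : Differentiable ℝ (fun α => f x α) := hfx.differentiable (by norm_num)
  have hgd : Differentiable ℝ (fun α => g x α) := hgx.differentiable (by norm_num)
  have hA : Differentiable ℝ (fun p : EuclideanSpace ℝ (Fin n) × EuclideanSpace ℝ (Fin m) =>
      ContinuousLinearMap.adjoint (fderiv ℝ (fun α => f p.1 α) p.2)) :=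
    (realAdjointCLM (EuclideanSpace ℝ (Fin m)) (EuclideanSpace ℝ (Fin d))).differentiable.comp
      hf.differentiable_partial_fderiv
  have hG := hg.differentiable_partial_gradient
  have hH : (∑ j : Fin d, z j • fderiv ℝ (gradient fun α => f x α j) a) +
      fderiv ℝ (gradient fun α => g x α) a =
      fderiv ℝ (fun α => ContinuousLinearMap.adjoint (fderiv ℝ (fun α => f x α) α) z +
        gradient (fun α => g x α) α) a := by
    have hsum : HasFDerivAt (fun α => (∑ j : Fin d, z j • gradient (fun α => f x α j) α) +
        gradient (fun α => g x α) α)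
        ((∑ j : Fin d, z j • fderiv ℝ (gradient fun α => f x α j) a) +
          fderiv ℝ (gradient fun α => g x α) a) a :=
      (HasFDerivAt.fun_sum fun j _ =>
        ((hfj j).differentiable_gradient a).hasFDerivAt.const_smul (z j)).add
          (hgx.differentiable_gradient a).hasFDerivAt
    rw [← hsum.fderiv]
    congr 1
    funext α
    rw [adjoint_fderiv_apply_eq_sum (hfd α)]
  have hHφ : (fun α => ContinuousLinearMap.adjoint (fderiv ℝ (fun α => f x α) α) z +
        gradient (fun α => g x α) α) = gradient (fun α => ⟪z, f x α⟫ + g x α) := by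
    funext α
    rw [gradient_add_of_differentiableAt ((differentiableAt_const z).inner ℝ (hfd α)) (hgd α),
      adjoint_fderiv_apply (hfd α)]
  rw [hH]
  set H := fderiv ℝ (fun α => ContinuousLinearMap.adjoint (fderiv ℝ (fun α => f x α) α) z +
        gradient (fun α => g x α) α) a with hHdef
  have hsymm : ContinuousLinearMap.adjoint H = H := by
    rw [hHdef, hHφ]
    exact ((contDiff_const.inner ℝ hfx).add hgx).adjoint_fderiv_gradient a
  have hΦ : DifferentiableAt ℝ
      (fun p : EuclideanSpace ℝ (Fin n) × EuclideanSpace ℝ (Fin m) =>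
        ContinuousLinearMap.adjoint (fderiv ℝ (fun α => f p.1 α) p.2) z +
          gradient (fun α => g p.1 α) p.2) (x, a) :=
    ((hA (x, a)).clm_apply (differentiableAt_const z)).add (hG (x, a))
  set M := fderiv ℝ (fun x' =>
          ContinuousLinearMap.adjoint (fderiv ℝ (fun α => f x' α) a) z +
            gradient (fun α => g x' α) a) x
  have hαx : DifferentiableAt ℝ (fun x' => αhat (x', z)) x :=
    hα.comp x (hasFDerivAt_prodMk_left x z).differentiableAt
  have hαz : DifferentiableAt ℝ (fun z' => αhat (x, z')) z :=
    hα.comp z (hasFDerivAt_prodMk_right x z).differentiableAt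
  have h1 : M + H.comp (fderiv ℝ (fun x' => αhat (x', z)) x) = 0 := by
    have hev : ∀ᶠ x' in nhds x,
        ContinuousLinearMap.adjoint (fderiv ℝ (fun α => f x' α) (αhat (x', z))) z +
          gradient (fun α => g x' α) (αhat (x', z)) = 0 :=
      ((continuous_id.prodMk continuous_const).tendsto' x (x, z) rfl).eventually hU' |>.mono
        fun x' hx' => hFOC (x', z) hx'
    exact fderiv_add_comp_fderiv_eq_zero
      (Φ := fun p : EuclideanSpace ℝ (Fin n) × EuclideanSpace ℝ (Fin m) =>
        ContinuousLinearMap.adjoint (fderiv ℝ (fun α => f p.1 α) p.2) z +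
          gradient (fun α => g p.1 α) p.2) (β := fun x' => αhat (x', z)) hΦ hαx hev
  have h2 : ContinuousLinearMap.adjoint (fderiv ℝ (fun α => f x α) a) +
      H.comp (fderiv ℝ (fun z' => αhat (x, z')) z) = 0 := by
    have hAx : DifferentiableAt ℝ
        (fun α => ContinuousLinearMap.adjoint (fderiv ℝ (fun α => f x α) α)) a :=
      (hA (x, a)).comp a (hasFDerivAt_prodMk_right x a).differentiableAt
    have hev : ∀ᶠ z' in nhds z,
        ContinuousLinearMap.adjoint (fderiv ℝ (fun α => f x α) (αhat (x, z'))) z' +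
          gradient (fun α => g x α) (αhat (x, z')) = 0 :=
      ((continuous_const.prodMk continuous_id).tendsto' z (x, z) rfl).eventually hU' |>.mono
        fun z' hz' => hFOC (x, z') hz'
    exact clm_add_comp_fderiv_eq_zero
      (C := fun α => ContinuousLinearMap.adjoint (fderiv ℝ (fun α => f x α) α))
      (G := gradient (fun α => g x α)) (β := fun z' => αhat (x, z'))
      hAx (hgx.differentiable_gradient a) hαz hev
  refine ⟨h1, h2, ?_⟩
  have h3 := congrArg ContinuousLinearMap.adjoint h2
  rw [map_add, ContinuousLinearMap.adjoint_adjoint, ContinuousLinearMap.adjoint_comp, hsymm,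
    map_zero] at h3
  rw [eq_neg_of_add_eq_zero_left h3, eq_neg_of_add_eq_zero_left h1]
  rw [ContinuousLinearMap.neg_comp, ContinuousLinearMap.comp_neg, ContinuousLinearMap.comp_assoc]
end
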